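/- Let m ≥ 1 and let A_b^{αβ}, B_b : B̄₂ → ℂ^{m×m} be bounded measurable coefficients satisfying the regularity bounds: there are 0 < c₁ < c₂ with c₁(|ξ₁|²+|ξ₂|²) ≤ Re Σ_{α,β=1}^2 [A_b^{αβ}(x) ξ_β]* ξ_α ≤ c₂(|ξ₁|²+|ξ₂|²) and c₁|η|² ≤ Re [B_b(x) η]* η ≤ c₂|η|² for all x, ξ₁, ξ₂, η. Let A_c = F_*A_b, B_c = F_*B_b on B₂ \ B̄₁. Let φ be a ℂ^m-valued C^∞ function on an open neighborhood of B̄₂. Then the function y ↦ Σ_{α,β=1}^2 (A_c^{αβ}(y) ∂_β φ(y))* ∂_α φ(y) + (B_c(y) φ(y))* φ(y) is Lebesgue integrable on B₂ \ B̄₁ if and only if the angular (tangential) derivative of φ vanishes on the unit circle, i.e. for every y ∈ S₁ and every component p ∈ {1,…,m}: ŷ^⊥ · ∇φ_p(y) = 0, where ŷ^⊥ is a unit vector orthogonal to y. -/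

import Mathlib

noncomputable section
open Metric Matrix MeasureTheory

/-- The blow-up map `F(x) = (1 + |x|/2) x/|x|`. -/
def Fmap (x : EuclideanSpace ℝ (Fin 2)) : EuclideanSpace ℝ (Fin 2) :=
  ((1 + ‖x‖ / 2) * ‖x‖⁻¹) • x

/-- Its inverse `y ↦ 2(|y| - 1) y/|y|` on `B₂ \ B̄₁`. -/
def Gmap (y : EuclideanSpace ℝ (Fin 2)) : EuclideanSpace ℝ (Fin 2) :=
  ((2 * (‖y‖ - 1)) * ‖y‖⁻¹) • y

/-- Standard basis vectors of `ℝ²`. -/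
def eb (i : Fin 2) : EuclideanSpace ℝ (Fin 2) := EuclideanSpace.single i 1

/-- `i`-th partial derivative of a `ℂ^m`-valued function. -/
def pd {m : ℕ} (i : Fin 2) (u : EuclideanSpace ℝ (Fin 2) → Fin m → ℂ)
    (x : EuclideanSpace ℝ (Fin 2)) : Fin m → ℂ :=
  fun p => fderiv ℝ (fun z => u z p) x (eb i)

/-- Jacobian determinant `det [∂F_i/∂x_j]` of a map `F : ℝ² → ℝ²`. -/
def Jdet (F : EuclideanSpace ℝ (Fin 2) → EuclideanSpace ℝ (Fin 2))
    (x : EuclideanSpace ℝ (Fin 2)) : ℝ :=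
  Matrix.det (Matrix.of fun i j => fderiv ℝ (fun z => F z i) x (eb j))

/-- Push-forward of the matrix coefficients `A = [A^{αβ}]` under `F` (with inverse `Finv`). -/
def pushA {m : ℕ} (F Finv : EuclideanSpace ℝ (Fin 2) → EuclideanSpace ℝ (Fin 2))
    (A : Fin 2 → Fin 2 → EuclideanSpace ℝ (Fin 2) → Matrix (Fin m) (Fin m) ℂ)
    (p q : Fin 2) (y : EuclideanSpace ℝ (Fin 2)) : Matrix (Fin m) (Fin m) ℂ :=
  ∑ α : Fin 2, ∑ β : Fin 2,
    ((fderiv ℝ (fun z => F z p) (Finv y) (eb β) *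
        fderiv ℝ (fun z => F z q) (Finv y) (eb α) * (Jdet F (Finv y))⁻¹ : ℝ)) •
      A α β (Finv y)

/-- Push-forward of the coefficient `B` under `F` (with inverse `Finv`). -/
def pushB {m : ℕ} (F Finv : EuclideanSpace ℝ (Fin 2) → EuclideanSpace ℝ (Fin 2))
    (B : EuclideanSpace ℝ (Fin 2) → Matrix (Fin m) (Fin m) ℂ)
    (y : EuclideanSpace ℝ (Fin 2)) : Matrix (Fin m) (Fin m) ℂ :=
  (Jdet F (Finv y))⁻¹ • B (Finv y)

/-- The vector `(−y₂, y₁)`, a tangential vector orthogonal to `y`, unit for `|y| = 1`. -/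
def perp (y : EuclideanSpace ℝ (Fin 2)) : EuclideanSpace ℝ (Fin 2) :=
  (EuclideanSpace.equiv (Fin 2) ℝ).symm ![-(y 1), y 0]

abbrev E2 := EuclideanSpace ℝ (Fin 2)

lemma perp_zero (y : E2) : perp y 0 = -(y 1) := by simp [perp]
lemma perp_one (y : E2) : perp y 1 = y 0 := by simp [perp]

lemma norm_sq_two (y : E2) : ‖y‖ ^ 2 = y 0 ^ 2 + y 1 ^ 2 := by
  rw [EuclideanSpace.norm_sq_eq]; simp [Fin.sum_univ_two]

lemma abs_coord_le (y : E2) (i : Fin 2) : |y i| ≤ ‖y‖ := by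
  have := norm_sq_two y
  apply abs_le_of_sq_le_sq _ (norm_nonneg y)
  fin_cases i <;> simp <;> nlinarith [sq_nonneg (y 0), sq_nonneg (y 1)]

lemma abs_perp_le (y : E2) (i : Fin 2) : |perp y i| ≤ ‖y‖ := by
  fin_cases i
  · simpa [perp_zero] using abs_coord_le y 1
  · simpa [perp_one] using abs_coord_le y 0

lemma hasFDerivAt_norm' (x : E2) (hx : x ≠ 0) :
    HasFDerivAt (fun z : E2 => ‖z‖) (‖x‖⁻¹ • innerSL ℝ x) x := by
  have h := (hasStrictFDerivAt_norm_sq x).hasFDerivAt.sqrt (by simpa using hx)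
  have hn : ‖x‖ ≠ 0 := by simpa using hx
  have e1 : (fun z : E2 => ‖z‖) = fun z => √(‖z‖ ^ 2) := by ext z; simp
  have e2 : ‖x‖⁻¹ • innerSL ℝ x = (1 / (2 * √(‖x‖ ^ 2))) • 2 • (innerSL ℝ) x := by
    ext v
    simp
    field_simp
  rw [e1, e2]
  exact h

lemma fderiv_Fmap (x : E2) (hx : x ≠ 0) (i j : Fin 2) :
    fderiv ℝ (fun z => Fmap z i) x (eb j) =
      (‖x‖⁻¹ + 1 / 2) * (if i = j then 1 else 0) - x i * x j / ‖x‖ ^ 3 := by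
  have hn : ‖x‖ ≠ 0 := by simpa using hx
  have h1 := hasFDerivAt_norm' x hx
  have h2 : HasFDerivAt (fun z : E2 => z i) (EuclideanSpace.proj i : E2 →L[ℝ] ℝ) x :=
    (EuclideanSpace.proj i : E2 →L[ℝ] ℝ).hasFDerivAt
  have h3 := (((h1.const_mul (1/2)).const_add 1).mul
    ((hasDerivAt_inv hn).comp_hasFDerivAt x h1)).mul h2
  have h4 : (fun z => Fmap z i) = (((fun z : E2 => 1 + 1/2 * ‖z‖) * ((fun y => y⁻¹) ∘ fun z : E2 => ‖z‖)) * fun z => z i) := by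
    ext z; simp [Fmap]; ring_nf; tauto
  rw [h4, h3.fderiv]
  have e1 : inner ℝ x (eb j) = x j := by simp [eb, EuclideanSpace.inner_single_right]
  have e2 : eb j i = if i = j then 1 else 0 := by simp [eb]
  simp [e1, e2]
  field_simp
  ring

lemma norm_Gmap (y : E2) (hy : 1 < ‖y‖) : ‖Gmap y‖ = 2 * (‖y‖ - 1) := by
  rw [Gmap, norm_smul, norm_mul, norm_inv, norm_norm, mul_assoc, inv_mul_cancel₀ (by linarith), mul_one,
    Real.norm_of_nonneg (by linarith)]

lemma fderiv_Fmap_Gmap (y : E2) (hy : 1 < ‖y‖) (i j : Fin 2) :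
    fderiv ℝ (fun z => Fmap z i) (Gmap y) (eb j) =
      (‖y‖ / (2 * (‖y‖ - 1))) * ((perp y i / ‖y‖) * (perp y j / ‖y‖)) +
        1 / 2 * ((y i / ‖y‖) * (y j / ‖y‖)) := by
  have hg := norm_Gmap y hy
  have hg0 : Gmap y ≠ 0 := by
    intro h; rw [h] at hg; simp at hg; linarith
  rw [fderiv_Fmap _ hg0, hg]
  have hs := norm_sq_two y
  have hr : ‖y‖ ≠ 0 := by linarith
  have hr1 : ‖y‖ - 1 ≠ 0 := by linarith
  have hG : ∀ k, Gmap y k = 2 * (‖y‖ - 1) * ‖y‖⁻¹ * y k := by intro k; simp [Gmap]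
  rw [hG, hG]
  have e : ∀ a b : ℝ, (2 * (‖y‖ - 1) * ‖y‖⁻¹ * a) * (2 * (‖y‖ - 1) * ‖y‖⁻¹ * b) / (2 * (‖y‖ - 1))^3
     = a * b / (‖y‖^2 * (2 * (‖y‖ - 1))) := by
    intro a b; field_simp
  rw [e]
  have hd : (if i = j then (1:ℝ) else 0) = (perp y i * perp y j + y i * y j) / ‖y‖^2 := by
    rw [eq_div_iff (by positivity), hs]
    fin_cases i <;> fin_cases j <;> simp [perp_zero, perp_one] <;> ring
  rw [hd]
  field_simp
  ring

lemma Jdet_Gmap (y : E2) (hy : 1 < ‖y‖) : Jdet Fmap (Gmap y) = ‖y‖ / (4 * (‖y‖ - 1)) := by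
  have hr : ‖y‖ ≠ 0 := by linarith
  have hr1 : ‖y‖ - 1 ≠ 0 := by linarith
  have hs := norm_sq_two y
  rw [Jdet, Matrix.det_fin_two]
  simp only [Matrix.of_apply, fderiv_Fmap_Gmap y hy, perp_zero, perp_one]
  have : ∀ a b a' b' k l : ℝ, (k * (a*a) + l * (a'*a')) * (k * (b*b) + l * (b'*b'))
     - (k * (a*b) + l * (a'*b')) * (k * (b*a) + l * (b'*a')) = k * l * (a * b' - b * a')^2 := by
    intros; ring
  rw [this]
  have h1 : (-(y 1) / ‖y‖ * (y 1 / ‖y‖) - y 0 / ‖y‖ * (y 0 / ‖y‖)) = -1 := by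
    field_simp; linarith
  rw [h1]; field_simp; norm_num

lemma K_bound (y : E2) (hy : 1 < ‖y‖) (p q α β : Fin 2) :
    |fderiv ℝ (fun z => Fmap z p) (Gmap y) (eb β) *
        fderiv ℝ (fun z => Fmap z q) (Gmap y) (eb α) * (Jdet Fmap (Gmap y))⁻¹ -
      (‖y‖ ^ 3 * (‖y‖ - 1))⁻¹ * (perp y p * perp y q * perp y α * perp y β)| ≤ 3 := by
  have hr : 0 < ‖y‖ := by linarith
  have hr1 : 0 < ‖y‖ - 1 := by linarith
  rw [fderiv_Fmap_Gmap y hy, fderiv_Fmap_Gmap y hy, Jdet_Gmap y hy]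
  have ht : ∀ i, |perp y i / ‖y‖| ≤ 1 := fun i => by
    rw [abs_div, abs_norm, div_le_one hr]; exact abs_perp_le y i
  have hn : ∀ i, |y i / ‖y‖| ≤ 1 := fun i => by
    rw [abs_div, abs_norm, div_le_one hr]; exact abs_coord_le y i
  have hp : ∀ i, perp y i = ‖y‖ * (perp y i / ‖y‖) := fun i => by field_simp
  have hc : |(‖y‖ - 1) / ‖y‖| ≤ 1 := by
    rw [abs_of_nonneg (by positivity), div_le_one hr]; linarith
  generalize hc' : (‖y‖ - 1) / ‖y‖ = c at hc
  have key : (‖y‖ ^ 3 * (‖y‖ - 1))⁻¹ * (perp y p * perp y q * perp y α * perp y β)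
    = c⁻¹ * (perp y p / ‖y‖ * (perp y q / ‖y‖) * (perp y α/ ‖y‖) * (perp y β / ‖y‖)) := by
    rw [← hc']; field_simp
  have k2 : (‖y‖ / (2 * (‖y‖ - 1))) = c⁻¹ / 2 := by rw [← hc']; field_simp
  have k3 : (‖y‖ / (4 * (‖y‖ - 1)))⁻¹ = 4 * c := by rw [← hc']; field_simp
  have hc0 : c ≠ 0 := by rw [← hc']; positivity
  rw [key, k2, k3]
  have a1 := ht p
  have a2 := ht q
  have a3 := ht α
  have a4 := ht β
  have b1 := hn p
  have b2 := hn q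
  have b3 := hn α
  have b4 := hn β
  generalize perp y p / ‖y‖ = t1 at *
  generalize perp y q / ‖y‖ = t2 at *
  generalize perp y α / ‖y‖ = t3 at *
  generalize perp y β / ‖y‖ = t4 at *
  generalize y p / ‖y‖ = n1 at *
  generalize y q / ‖y‖ = n2 at *
  generalize y α / ‖y‖ = n3 at *
  generalize y β / ‖y‖ = n4 at *
  have e : (c⁻¹ / 2 * (t1 * t4) + 1 / 2 * (n1 * n4)) * (c⁻¹ / 2 * (t2 * t3) + 1 / 2 * (n2 * n3)) * (4 * c) -
      c⁻¹ * (t1 * t2 * t3 * t4) = t1 * t4 * n2 * n3 + n1 * n4 * t2 * t3 + c * (n1 * n4 * n2 * n3) := by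
    field_simp; ring
  rw [e]
  have m4 : ∀ a b c d : ℝ, |a| ≤ 1 → |b| ≤ 1 → |c| ≤ 1 → |d| ≤ 1 → |a * b * c * d| ≤ 1 := by
    intro a b c d h1 h2 h3 h4
    rw [abs_mul, abs_mul, abs_mul]
    exact mul_le_one₀ (mul_le_one₀ (mul_le_one₀ h1 (abs_nonneg _) h2) (abs_nonneg _) h3)
      (abs_nonneg _) h4
  have x1 := m4 _ _ _ _ a1 a4 b2 b3
  have x2 := m4 _ _ _ _ b1 b4 a2 a3
  have x3 : |c * (n1 * n4 * n2 * n3)| ≤ 1 := by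
    rw [abs_mul]; exact mul_le_one₀ hc (abs_nonneg _) (m4 _ _ _ _ b1 b4 b2 b3)
  rw [abs_le] at *
  constructor <;> linarith [x1.1, x1.2, x2.1, x2.2, x3.1, x3.2]

lemma form_bound {m : ℕ} (A : Matrix (Fin m) (Fin m) ℂ) (M a b : ℝ) (hA : ∀ p q, ‖A p q‖ ≤ M)
    (u v : Fin m → ℂ) (hu : ∀ p, ‖u p‖ ≤ a) (hv : ∀ p, ‖v p‖ ≤ b) (hM : 0 ≤ M) (ha : 0 ≤ a) :
    ‖star (A.mulVec u) ⬝ᵥ v‖ ≤ (m * (m * (M * a) * b) : ℝ) := by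
  rw [dotProduct]
  refine (norm_sum_le _ _).trans ?_
  have : ∀ i ∈ Finset.univ, ‖star (A.mulVec u) i * v i‖ ≤ (m * (M * a) * b : ℝ) := by
    intro i _
    rw [norm_mul, Pi.star_apply, norm_star]
    refine mul_le_mul ?_ (hv i) (norm_nonneg _) (by positivity)
    rw [mulVec, dotProduct]
    refine (norm_sum_le _ _).trans ?_
    have : ∀ j ∈ Finset.univ, ‖A i j * u j‖ ≤ (M * a : ℝ) := by
      intro j _
      rw [norm_mul]
      exact mul_le_mul (hA i j) (hu j) (norm_nonneg _) hM
    refine (Finset.sum_le_card_nsmul _ _ _ this).trans ?_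
    simp
  refine (Finset.sum_le_card_nsmul _ _ _ this).trans ?_
  simp

lemma form_smul {m : ℕ} (A : Matrix (Fin m) (Fin m) ℂ) (k : ℝ) (u v : Fin m → ℂ) :
    star ((k • A).mulVec u) ⬝ᵥ v = (k : ℂ) * (star (A.mulVec u) ⬝ᵥ v) := by
  rw [smul_mulVec]
  simp [dotProduct, Finset.mul_sum, mul_assoc]

lemma pushA_form {m : ℕ} (Ab : Fin 2 → Fin 2 → E2 → Matrix (Fin m) (Fin m) ℂ) (p q : Fin 2) (y : E2)
    (u v : Fin m → ℂ) :
    star ((pushA Fmap Gmap Ab p q y).mulVec u) ⬝ᵥ v = ∑ α : Fin 2, ∑ β : Fin 2,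
      ((fderiv ℝ (fun z => Fmap z p) (Gmap y) (eb β) *
        fderiv ℝ (fun z => Fmap z q) (Gmap y) (eb α) * (Jdet Fmap (Gmap y))⁻¹ : ℝ) : ℂ) *
        (star ((Ab α β (Gmap y)).mulVec u) ⬝ᵥ v) := by
  rw [pushA]
  simp only [Fin.sum_univ_two, add_mulVec, star_add, add_dotProduct, form_smul]

lemma form_W {m : ℕ} (A : Fin 2 → Fin 2 → Matrix (Fin m) (Fin m) ℂ) (t : Fin 2 → ℝ)
    (u : Fin 2 → Fin m → ℂ) :
    (∑ α : Fin 2, ∑ β : Fin 2, star ((A α β).mulVec (t β • ∑ q : Fin 2, t q • u q)) ⬝ᵥ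
      (t α • ∑ q : Fin 2, t q • u q)) =
    ∑ p : Fin 2, ∑ q : Fin 2, ∑ α : Fin 2, ∑ β : Fin 2, ((t p * t q * t α * t β : ℝ) : ℂ) *
      (star ((A α β).mulVec (u q)) ⬝ᵥ u p) := by
  simp only [Fin.sum_univ_two, mulVec_add, mulVec_smul, star_add, star_smul, add_dotProduct,
    dotProduct_add, smul_dotProduct, dotProduct_smul, Complex.real_smul, smul_add, star_trivial,
    Complex.ofReal_mul]
  ring

lemma energy_split {m : ℕ} (Ab : Fin 2 → Fin 2 → E2 → Matrix (Fin m) (Fin m) ℂ) (M : ℝ) (hM : 0 ≤ M)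
    (hAbd : ∀ α β x p q, ‖Ab α β x p q‖ ≤ M) (y : E2) (hy : 1 < ‖y‖) (u : Fin 2 → Fin m → ℂ)
    (a : ℝ) (ha : 0 ≤ a) (hu : ∀ i p, ‖u i p‖ ≤ a) :
    ‖(∑ α : Fin 2, ∑ β : Fin 2,
          star ((pushA Fmap Gmap Ab α β y).mulVec (u β)) ⬝ᵥ u α) -
      (((‖y‖ ^ 3 * (‖y‖ - 1))⁻¹ : ℝ) : ℂ) * (∑ α : Fin 2, ∑ β : Fin 2,
        star ((Ab α β (Gmap y)).mulVec (perp y β • ∑ q : Fin 2, perp y q • u q)) ⬝ᵥ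
      (perp y α • ∑ q : Fin 2, perp y q • u q))‖ ≤ 48 * (m * (m * (M * a) * a)) := by
  rw [form_W (fun α β => Ab α β (Gmap y)) (fun i => perp y i)]
  simp only [pushA_form, Finset.mul_sum, ← Finset.sum_sub_distrib, ← mul_assoc, ← sub_mul,
    ← Complex.ofReal_mul, ← Complex.ofReal_sub]
  set C : ℝ := m * (m * (M * a) * a) with hC
  have h : ∀ p q α β : Fin 2, ‖((fderiv ℝ (fun z => Fmap z p) (Gmap y) (eb β) *
        fderiv ℝ (fun z => Fmap z q) (Gmap y) (eb α) * (Jdet Fmap (Gmap y))⁻¹ -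
      (‖y‖ ^ 3 * (‖y‖ - 1))⁻¹ * perp y p * perp y q * perp y α * perp y β : ℝ) : ℂ) *
      (star ((Ab α β (Gmap y)).mulVec (u q)) ⬝ᵥ u p)‖ ≤ 3 * C := by
    intro p q α β
    rw [norm_mul, Complex.norm_real, Real.norm_eq_abs]
    refine mul_le_mul ?_ (form_bound _ M a a (hAbd α β _) _ _ (hu q) (hu p) hM ha) (norm_nonneg _) (by norm_num)
    simpa only [mul_assoc] using K_bound y hy p q α β
  have s2 : ∀ (f : Fin 2 → ℂ) (c : ℝ), (∀ i, ‖f i‖ ≤ c) → ‖∑ i, f i‖ ≤ 2 * c := by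
    intro f c hf
    rw [Fin.sum_univ_two]
    linarith [norm_add_le (f 0) (f 1), hf 0, hf 1]
  have : 48 * C = 2 * (2 * (2 * (2 * (3 * C)))) := by ring
  have h48 : (48 * m * m * M * a * a : ℝ) = 48 * C := by rw [hC]; ring
  rw [h48, this]
  exact s2 _ _ fun p => s2 _ _ fun q => s2 _ _ fun α => s2 _ _ fun β => h p q α β

open Filter Topology Pointwise in
lemma not_int (f : E2 → ℝ) (y0 : E2) (hy0 : ‖y0‖ = 1) (c C ρ : ℝ) (hc : 0 < c) (hC : 0 ≤ C)
    (hρ : 0 < ρ) (hf : IntegrableOn f (ball (0 : E2) 2 \ closedBall 0 1))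
    (h : ∀ y ∈ ball y0 ρ, 1 < ‖y‖ → ‖y‖ < 2 → c / (‖y‖ - 1) - C ≤ f y) : False := by
  let S : Set E2 := {y | ‖y‖⁻¹ • y ∈ ball y0 (ρ / 2)}
  have hS : MeasurableSet S := by
    have : Measurable fun y : E2 => ‖y‖⁻¹ • y := by fun_prop
    exact this measurableSet_ball
  have hSc : ∀ (t : ℝ), 0 < t → ∀ y, t • y ∈ S ↔ y ∈ S := by
    intro t ht y
    have : ‖t • y‖⁻¹ • t • y = ‖y‖⁻¹ • y := by
      rw [norm_smul, Real.norm_of_nonneg ht.le, smul_smul, mul_inv]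
      congr 1
      field_simp
    simp only [S, Set.mem_ofPred_eq, this]
  let κ := volume.real (S ∩ closedBall 0 1)
  have hfin : ∀ t : ℝ, volume (S ∩ closedBall 0 t) ≠ ⊤ := fun t =>
    ((measure_mono Set.inter_subset_right).trans_lt measure_closedBall_lt_top).ne
  have hκ : 0 < κ := by
    refine ENNReal.toReal_pos ?_ (hfin 1)
    have hn : S ∩ closedBall 0 1 ∈ 𝓝 ((1 / 2 : ℝ) • y0) := by
      have hhalf : ‖(1 / 2 : ℝ) • y0‖ = 1 / 2 := by rw [norm_smul, hy0]; norm_num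
      refine inter_mem ?_ ?_
      · have hcont : ContinuousAt (fun y : E2 => ‖y‖⁻¹ • y) ((1 / 2 : ℝ) • y0) := by
          refine ContinuousAt.smul (ContinuousAt.inv₀ continuous_norm.continuousAt ?_) continuousAt_id
          rw [hhalf]; norm_num
        apply hcont
        have : ‖(1 / 2 : ℝ) • y0‖⁻¹ • (1 / 2 : ℝ) • y0 = y0 := by
          rw [hhalf, smul_smul]; norm_num
        simp only [this]
        exact ball_mem_nhds _ (by positivity)
      · refine mem_of_superset (isOpen_ball.mem_nhds (x := (1 / 2 : ℝ) • y0) (s := ball 0 1) ?_) ball_subset_closedBall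
        rw [mem_ball_zero_iff, hhalf]; norm_num
    exact (Measure.measure_pos_of_mem_nhds volume hn).ne'
  have hvol : ∀ t : ℝ, 0 < t → volume.real (S ∩ closedBall 0 t) = t ^ 2 * κ := by
    intro t ht
    have : S ∩ closedBall 0 t = t • (S ∩ closedBall (0 : E2) 1) := by
      ext y
      rw [Set.mem_smul_set_iff_inv_smul_mem₀ ht.ne']
      simp only [Set.mem_inter_iff, hSc _ (inv_pos.2 ht), mem_closedBall_zero_iff, norm_smul,
        norm_inv, Real.norm_of_nonneg ht.le]
      rw [inv_mul_le_iff₀ ht, mul_one]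
    rw [this, measureReal_def, Measure.addHaar_smul, ENNReal.toReal_mul, finrank_euclideanSpace_fin,
      ENNReal.toReal_ofReal (abs_nonneg _), abs_of_nonneg (by positivity)]
    rfl
  let T : ℕ → Set E2 := fun n => (S ∩ closedBall 0 (1 + 1 / ((n : ℝ) + 2))) \ (S ∩ closedBall 0 1)
  have hTm : ∀ n, MeasurableSet (T n) := fun n =>
    (hS.inter measurableSet_closedBall).diff (hS.inter measurableSet_closedBall)
  have hε : ∀ n : ℕ, 0 < 1 / ((n : ℝ) + 2) ∧ 1 / ((n : ℝ) + 2) < 1 := by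
    intro n
    refine ⟨by positivity, ?_⟩
    rw [div_lt_one (by positivity)]
    have : (0:ℝ) ≤ n := by positivity
    linarith
  have hTmem : ∀ n y, y ∈ T n ↔ y ∈ S ∧ 1 < ‖y‖ ∧ ‖y‖ ≤ 1 + 1 / ((n : ℝ) + 2) := by
    intro n y
    simp only [T, Set.mem_sdiff, Set.mem_inter_iff, mem_closedBall_zero_iff, ← not_le]
    tauto
  have hTa : Antitone T := by
    intro a b hab y
    rw [hTmem, hTmem]
    rintro ⟨h1, h2, h3⟩
    refine ⟨h1, h2, h3.trans ?_⟩
    gcongr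
  have hTsub : ∀ n, T n ⊆ ball (0 : E2) 2 \ closedBall 0 1 := by
    intro n y hy
    rw [hTmem] at hy
    rw [Set.mem_sdiff, mem_ball_zero_iff, mem_closedBall_zero_iff, not_le]
    exact ⟨by linarith [(hε n).2], hy.2.1⟩
  have hlim0 : Tendsto (fun n : ℕ => 1 / ((n : ℝ) + 2)) atTop (𝓝 0) := by
    have := (tendsto_one_div_add_atTop_nhds_zero_nat (𝕜 := ℝ)).comp (tendsto_add_atTop_nat 1)
    refine this.congr fun n => ?_
    simp; ring
  have hTe : ⋂ n, T n = ∅ := by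
    rw [Set.eq_empty_iff_forall_notMem]
    intro y hy
    simp only [Set.mem_iInter, hTmem] at hy
    have h1 := (hy 0).2.1
    have : ‖y‖ ≤ 1 + 0 := ge_of_tendsto' (hlim0.const_add 1) fun n => (hy n).2.2
    linarith
  have hlim := tendsto_setIntegral_of_antitone (μ := volume) (f := f) hTm hTa ⟨0, hf.mono_set (hTsub 0)⟩
  rw [hTe, setIntegral_empty] at hlim
  have hvT : ∀ n, volume.real (T n) = (2 * (1 / ((n : ℝ) + 2)) + (1 / ((n : ℝ) + 2)) ^ 2) * κ := by
    intro n
    have := measureReal_sdiff (μ := volume) (s₁ := S ∩ closedBall 0 (1 + 1 / ((n : ℝ) + 2)))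
      (s₂ := S ∩ closedBall 0 1)
      (Set.inter_subset_inter_right _ (closedBall_subset_closedBall (by linarith [(hε n).1])))
      (hS.inter measurableSet_closedBall) (hfin _)
    rw [hvol _ (by linarith [(hε n).1])] at this
    change volume.real (T n) = _ - κ at this
    rw [this]; ring
  have hev : ∀ᶠ n : ℕ in atTop, c * κ ≤ ∫ x in T n, f x := by
    have h1 : ∀ᶠ n : ℕ in atTop, 1 / ((n : ℝ) + 2) < ρ / 2 := hlim0.eventually_lt_const (by positivity)
    have h2 : ∀ᶠ n : ℕ in atTop, C * (1 / ((n : ℝ) + 2)) < c / 2 := by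
      have := hlim0.const_mul C
      rw [mul_zero] at this
      exact this.eventually_lt_const (by positivity)
    filter_upwards [h1, h2] with n h1 h2
    have hb : ∀ y ∈ T n, c / (1 / ((n : ℝ) + 2)) - C ≤ f y := by
      intro y hy
      have hy' := (hTmem n y).1 hy
      refine le_trans ?_ (h y ?_ hy'.2.1 (by linarith [(hε n).2]))
      · have : 0 < ‖y‖ - 1 := by linarith [hy'.2.1]
        have h3 : ‖y‖ - 1 ≤ 1 / ((n : ℝ) + 2) := by linarith [hy'.2.2]
        gcongr
      · have hs : ‖y‖⁻¹ • y ∈ ball y0 (ρ / 2) := hy'.1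
        have hd : dist y (‖y‖⁻¹ • y) = ‖y‖ - 1 := by
          have hpos : ‖y‖ ≠ 0 := by linarith [hy'.2.1]
          have : y - ‖y‖⁻¹ • y = ((‖y‖ - 1) * ‖y‖⁻¹) • y := by
            rw [sub_mul, mul_inv_cancel₀ hpos, sub_smul, one_smul, one_mul]
          rw [dist_eq_norm, this, norm_smul, norm_mul, norm_inv, norm_norm, mul_assoc,
            inv_mul_cancel₀ hpos, mul_one, Real.norm_of_nonneg (by linarith [hy'.2.1])]
        rw [mem_ball] at hs ⊢
        have := dist_triangle y (‖y‖⁻¹ • y) y0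
        linarith [hy'.2.2]
    have hfinT : volume (T n) ≠ ⊤ := ((measure_mono Set.sdiff_subset).trans_lt (hfin _).lt_top).ne
    have := setIntegral_ge_of_const_le_real (hTm n) hfinT hb (hf.mono_set (hTsub n))
    refine le_trans ?_ this
    rw [hvT]
    have e0 := (hε n).1
    have e1 := (hε n).2
    generalize 1 / ((n : ℝ) + 2) = ε at *
    have : (c / ε - C) * ((2 * ε + ε ^ 2) * κ) = (c - C * ε) * (2 + ε) * κ := by
      field_simp
    rw [this]
    have : c ≤ (c - C * ε) * (2 + ε) := by nlinarith
    gcongr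
  have := ge_of_tendsto hlim hev
  have : 0 < c * κ := by positivity
  linarith

lemma perp_sum {m : ℕ} (φ : E2 → Fin m → ℂ) (y : E2) :
    (∑ q : Fin 2, perp y q • pd q φ y) = fun p => fderiv ℝ (fun z => φ z p) y (perp y) := by
  have : perp y = ∑ q : Fin 2, perp y q • eb q := by
    ext i; fin_cases i <;> simp [eb, Fin.sum_univ_two]
  ext p
  conv_rhs => rw [this]
  simp [pd, Fin.sum_univ_two]

lemma pushB_bound {m : ℕ} (Bb : E2 → Matrix (Fin m) (Fin m) ℂ) (M : ℝ) (hM : 0 ≤ M)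
    (hBbd : ∀ x p q, ‖Bb x p q‖ ≤ M) (y : E2) (hy : 1 < ‖y‖) (u : Fin m → ℂ)
    (a : ℝ) (ha : 0 ≤ a) (hu : ∀ p, ‖u p‖ ≤ a) :
    ‖star ((pushB Fmap Gmap Bb y).mulVec u) ⬝ᵥ u‖ ≤ 4 * (m * (m * (M * a) * a)) := by
  rw [pushB, form_smul, norm_mul, Complex.norm_real, Jdet_Gmap y hy]
  refine mul_le_mul ?_ (form_bound _ M a a (hBbd _) _ _ hu hu hM ha) (norm_nonneg _) (by norm_num)
  have : 0 < ‖y‖ - 1 := by linarith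
  rw [Real.norm_of_nonneg (by positivity), inv_div, div_le_iff₀ (by linarith)]
  linarith

lemma contDiff_perp : ContDiff ℝ 1 perp := by
  have : ContDiff ℝ 1 (fun y : E2 => ![-(y 1), y 0]) := by
    rw [contDiff_pi]
    intro i; fin_cases i <;> simp <;> fun_prop
  exact (EuclideanSpace.equiv (Fin 2) ℝ).symm.contDiff.comp this

lemma W_contDiffOn {m : ℕ} (φ : E2 → Fin m → ℂ)
    (U : Set E2) (hU : IsOpen U) (hφ : ContDiffOn ℝ (⊤ : ℕ∞) φ U) (p : Fin m) :
    ContDiffOn ℝ 1 (fun y => fderiv ℝ (fun z => φ z p) y (perp y)) U := by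
  have h1 : ContDiffOn ℝ (⊤ : ℕ∞) (fun z => φ z p) U := contDiffOn_pi.1 hφ p
  have h2 : ContDiffOn ℝ 1 (fderiv ℝ (fun z => φ z p)) U :=
    h1.fderiv_of_isOpen hU (by norm_cast)
  exact h2.clm_apply contDiff_perp.contDiffOn

lemma exists_bound {m : ℕ} (φ : E2 → Fin m → ℂ)
    (U : Set E2) (hU : IsOpen U) (hUsub : closedBall (0 : E2) 2 ⊆ U) 
    (hφ : ContDiffOn ℝ (⊤ : ℕ∞) φ U) :
    ∃ a : ℝ, 0 ≤ a ∧ ∀ y ∈ closedBall (0 : E2) 2, (∀ p, ‖φ y p‖ ≤ a) ∧ ∀ i p, ‖pd i φ y p‖ ≤ a := by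
  have hK : IsCompact (closedBall (0 : E2) 2) := isCompact_closedBall _ _
  obtain ⟨a, ha⟩ := hK.exists_bound_of_continuousOn (hφ.continuousOn.mono hUsub)
  have h2 : ContinuousOn (fun y => fun (i : Fin 2) => pd i φ y) (closedBall (0 : E2) 2) := by
    rw [continuousOn_pi]; intro i
    rw [continuousOn_pi]; intro p
    have h1 : ContDiffOn ℝ (⊤ : ℕ∞) (fun z => φ z p) U := contDiffOn_pi.1 hφ p
    exact ((h1.continuousOn_fderiv_of_isOpen hU (by norm_cast)).clm_apply continuousOn_const).mono hUsub
  obtain ⟨b, hb⟩ := hK.exists_bound_of_continuousOn h2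
  refine ⟨max 0 (max a b), le_max_left _ _, fun y hy => ⟨fun p => ?_, fun i p => ?_⟩⟩
  · exact ((norm_le_pi_norm _ p).trans (ha y hy)).trans ((le_max_left _ _).trans (le_max_right _ _))
  · exact (((norm_le_pi_norm _ p).trans (norm_le_pi_norm (fun i => pd i φ y) i)).trans (hb y hy)).trans
      ((le_max_right _ _).trans (le_max_right _ _))

lemma W_lip {m : ℕ} (φ : E2 → Fin m → ℂ)
    (U : Set E2) (hU : IsOpen U) (hUsub : closedBall (0 : E2) 2 ⊆ U)
    (hφ : ContDiffOn ℝ (⊤ : ℕ∞) φ U)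
    (h0 : ∀ y : E2, ‖y‖ = 1 → ∀ p : Fin m, fderiv ℝ (fun z => φ z p) y (perp y) = 0) :
    ∃ K : ℝ, 0 ≤ K ∧ ∀ y : E2, 1 < ‖y‖ → ‖y‖ < 2 → ∀ p,
      ‖fderiv ℝ (fun z => φ z p) y (perp y)‖ ≤ K * (‖y‖ - 1) := by
  have key : ∀ p, ∃ K : ℝ, ∀ y : E2, 1 < ‖y‖ → ‖y‖ < 2 →
      ‖fderiv ℝ (fun z => φ z p) y (perp y)‖ ≤ K * (‖y‖ - 1) := by
    intro p
    have hW := W_contDiffOn φ U hU hφ p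
    set W := (fun y => fderiv ℝ (fun z => φ z p) y (perp y)) with hWdef
    have hK : IsCompact (closedBall (0 : E2) 2) := isCompact_closedBall _ _
    obtain ⟨K, hK⟩ := hK.exists_bound_of_continuousOn
      ((hW.continuousOn_fderiv_of_isOpen hU le_rfl).mono hUsub)
    refine ⟨K, fun y hy1 hy2 => ?_⟩
    have hpos : ‖y‖ ≠ 0 := by linarith
    have hn : ‖‖y‖⁻¹ • y‖ = 1 := by
      rw [norm_smul, norm_inv, norm_norm, inv_mul_cancel₀ hpos]
    have := (convex_closedBall (0 : E2) 2).norm_image_sub_le_of_norm_fderiv_le (𝕜 := ℝ) (f := W)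
      (fun x hx => (hW.differentiableOn (by norm_num)).differentiableAt (hU.mem_nhds (hUsub hx))) hK
      (x := ‖y‖⁻¹ • y) (y := y) (by rw [mem_closedBall_zero_iff, hn]; norm_num)
      (by rw [mem_closedBall_zero_iff]; exact hy2.le)
    have hz : W (‖y‖⁻¹ • y) = 0 := h0 _ hn p
    have hd : ‖y - ‖y‖⁻¹ • y‖ = ‖y‖ - 1 := by
      have : y - ‖y‖⁻¹ • y = ((‖y‖ - 1) * ‖y‖⁻¹) • y := by
        rw [sub_mul, mul_inv_cancel₀ hpos, sub_smul, one_smul, one_mul]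
      rw [this, norm_smul, norm_mul, norm_inv, norm_norm, mul_assoc,
        inv_mul_cancel₀ hpos, mul_one, Real.norm_of_nonneg (by linarith)]
    rwa [hz, sub_zero, hd] at this
  choose K hK using key
  refine ⟨∑ p, |K p|, Finset.sum_nonneg fun _ _ => abs_nonneg _, fun y h1 h2 p => (hK p y h1 h2).trans ?_⟩
  have : K p ≤ ∑ p, |K p| := (le_abs_self _).trans
    (Finset.single_le_sum (f := fun p => |K p|) (fun _ _ => abs_nonneg _) (Finset.mem_univ p))
  have : 0 ≤ ‖y‖ - 1 := by linarith
  gcongr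

lemma entry_measurable_A {m : ℕ} (Ab : Fin 2 → Fin 2 → E2 → Matrix (Fin m) (Fin m) ℂ)
    (hAmeas : ∀ α β p q, Measurable fun x => Ab α β x p q) (hG : Measurable Gmap)
    (hD : ∀ i j, Measurable fun x => fderiv ℝ (fun z => Fmap z i) x (eb j))
    (hJ : Measurable (Jdet Fmap)) (p q i j) :
    Measurable fun y => pushA Fmap Gmap Ab p q y i j := by
  simp only [pushA, Matrix.sum_apply, Matrix.smul_apply]
  refine Finset.measurable_sum _ fun α _ => Finset.measurable_sum _ fun β _ => ?_
  exact ((((hD p β).comp hG).mul ((hD q α).comp hG)).mul (hJ.comp hG).inv).smul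
    ((hAmeas α β i j).comp hG)

lemma f_meas {m : ℕ} 
    (Ab : Fin 2 → Fin 2 → EuclideanSpace ℝ (Fin 2) → Matrix (Fin m) (Fin m) ℂ)
    (Bb : EuclideanSpace ℝ (Fin 2) → Matrix (Fin m) (Fin m) ℂ)
    (hAmeas : ∀ α β p q, Measurable fun x => Ab α β x p q)
    (hBmeas : ∀ p q, Measurable fun x => Bb x p q)
    (φ : EuclideanSpace ℝ (Fin 2) → Fin m → ℂ) (s : Set E2) (hs : MeasurableSet s)
    (hφ : ContinuousOn φ s) :
    AEMeasurable (fun y =>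
        (∑ α : Fin 2, ∑ β : Fin 2,
          star ((pushA Fmap Gmap Ab α β y).mulVec (pd β φ y)) ⬝ᵥ pd α φ y) +
        star ((pushB Fmap Gmap Bb y).mulVec (φ y)) ⬝ᵥ φ y) (volume.restrict s) := by
  have hG : Measurable Gmap := by unfold Gmap; fun_prop
  have hstar : Measurable (star : ℂ → ℂ) := continuous_star.measurable
  have hD : ∀ i j, Measurable fun x => fderiv ℝ (fun z => Fmap z i) x (eb j) := fun i j =>
    measurable_fderiv_apply_const _ _ _
  have hJ : Measurable (Jdet Fmap) := by
    unfold Jdet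
    simp only [Matrix.det_fin_two, Matrix.of_apply]
    exact ((hD _ _).mul (hD _ _)).sub ((hD _ _).mul (hD _ _))
  have hpd : ∀ i p, Measurable fun y => pd i φ y p := fun i p =>
    measurable_fderiv_apply_const _ _ _
  have hφm : ∀ p, AEMeasurable (fun y => φ y p) (volume.restrict s) := fun p =>
    ((continuousOn_pi.1 hφ p).aestronglyMeasurable hs).aemeasurable
  have hB : ∀ i j, Measurable fun y => pushB Fmap Gmap Bb y i j := fun i j => by
    simp only [pushB, Matrix.smul_apply]
    exact (hJ.comp hG).inv.smul ((hBmeas i j).comp hG)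
  refine AEMeasurable.add (Measurable.aemeasurable ?_) ?_
  · refine Finset.measurable_sum _ fun α _ => Finset.measurable_sum _ fun β _ => ?_
    simp only [dotProduct, mulVec, Pi.star_apply]
    refine Finset.measurable_sum _ fun i _ => Measurable.mul (hstar.comp ?_) (hpd _ _)
    exact Finset.measurable_sum _ fun j _ => 
      (entry_measurable_A Ab hAmeas hG hD hJ _ _ _ _).mul (hpd _ _)
  · simp only [dotProduct, mulVec, Pi.star_apply]
    refine Finset.aemeasurable_fun_sum _ fun i _ => AEMeasurable.mul (hstar.comp_aemeasurable ?_) (hφm _)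
    exact Finset.aemeasurable_fun_sum _ fun j _ => (hB _ _).aemeasurable.mul (hφm _)

/-- for a smooth `φ` on a neighborhood of `B̄₂`, the cloaking energy density
`Σ (A_c^{αβ}∂_βφ)*∂_αφ + (B_cφ)*φ` is Lebesgue integrable on `B₂ \ B̄₁` if and only if the
angular derivative of every component of `φ` vanishes on the unit circle. -/
theorem stmt_10 {m : ℕ} (hm : 1 ≤ m)
    (Ab : Fin 2 → Fin 2 → EuclideanSpace ℝ (Fin 2) → Matrix (Fin m) (Fin m) ℂ)
    (Bb : EuclideanSpace ℝ (Fin 2) → Matrix (Fin m) (Fin m) ℂ)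
    (hAmeas : ∀ α β p q, Measurable fun x => Ab α β x p q)
    (hBmeas : ∀ p q, Measurable fun x => Bb x p q)
    (M : ℝ) (hAbd : ∀ α β x p q, ‖Ab α β x p q‖ ≤ M) (hBbd : ∀ x p q, ‖Bb x p q‖ ≤ M)
    (c₁ c₂ : ℝ) (hc₁ : 0 < c₁) (hc₁₂ : c₁ < c₂)
    (hAreg : ∀ (x : EuclideanSpace ℝ (Fin 2)) (ξ : Fin 2 → Fin m → ℂ),
      c₁ * (∑ l : Fin 2, ∑ p : Fin m, ‖ξ l p‖ ^ 2) ≤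
        (∑ α : Fin 2, ∑ β : Fin 2, star ((Ab α β x).mulVec (ξ β)) ⬝ᵥ ξ α).re ∧
      (∑ α : Fin 2, ∑ β : Fin 2, star ((Ab α β x).mulVec (ξ β)) ⬝ᵥ ξ α).re ≤
        c₂ * (∑ l : Fin 2, ∑ p : Fin m, ‖ξ l p‖ ^ 2))
    (hBreg : ∀ (x : EuclideanSpace ℝ (Fin 2)) (η : Fin m → ℂ),
      c₁ * (∑ p : Fin m, ‖η p‖ ^ 2) ≤ (star ((Bb x).mulVec η) ⬝ᵥ η).re ∧
      (star ((Bb x).mulVec η) ⬝ᵥ η).re ≤ c₂ * (∑ p : Fin m, ‖η p‖ ^ 2))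
    (φ : EuclideanSpace ℝ (Fin 2) → Fin m → ℂ)
    (U : Set (EuclideanSpace ℝ (Fin 2))) (hU : IsOpen U)
    (hUsub : closedBall (0 : EuclideanSpace ℝ (Fin 2)) 2 ⊆ U)
    (hφ : ContDiffOn ℝ (⊤ : ℕ∞) φ U) :
    IntegrableOn (fun y =>
        (∑ α : Fin 2, ∑ β : Fin 2,
          star ((pushA Fmap Gmap Ab α β y).mulVec (pd β φ y)) ⬝ᵥ pd α φ y) +
        star ((pushB Fmap Gmap Bb y).mulVec (φ y)) ⬝ᵥ φ y)
      (ball (0 : EuclideanSpace ℝ (Fin 2)) 2 \ closedBall 0 1) ↔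
    ∀ y : EuclideanSpace ℝ (Fin 2), ‖y‖ = 1 → ∀ p : Fin m,
      fderiv ℝ (fun z => φ z p) y (perp y) = 0 := by

  have hM : 0 ≤ M := (norm_nonneg _).trans (hBbd 0 ⟨0, hm⟩ ⟨0, hm⟩)
  obtain ⟨a, ha, hab⟩ := exists_bound φ U hU hUsub hφ
  set f : E2 → ℂ := (fun y =>
        (∑ α : Fin 2, ∑ β : Fin 2,
          star ((pushA Fmap Gmap Ab α β y).mulVec (pd β φ y)) ⬝ᵥ pd α φ y) +
        star ((pushB Fmap Gmap Bb y).mulVec (φ y)) ⬝ᵥ φ y) with hf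
  let W : E2 → Fin m → ℂ := fun y p => fderiv ℝ (fun z => φ z p) y (perp y)
  let L : E2 → ℂ := fun y => ∑ α : Fin 2, ∑ β : Fin 2,
        star ((Ab α β (Gmap y)).mulVec (perp y β • W y)) ⬝ᵥ (perp y α • W y)
  set C : ℝ := 52 * (m * (m * (M * a) * a)) with hC
  have hC0 : 0 ≤ C := by positivity
  have hsplit : ∀ y : E2, 1 < ‖y‖ → ‖y‖ < 2 →
      ‖f y - (((‖y‖ ^ 3 * (‖y‖ - 1))⁻¹ : ℝ) : ℂ) * L y‖ ≤ C := by
    intro y h1 h2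
    have hy : y ∈ closedBall (0 : E2) 2 := by rw [mem_closedBall_zero_iff]; exact h2.le
    have hA := energy_split Ab M hM hAbd y h1 (fun i => pd i φ y) a ha (hab y hy).2
    have hB := pushB_bound Bb M hM hBbd y h1 (φ y) a ha (hab y hy).1
    simp only [perp_sum] at hA
    have e : f y - (((‖y‖ ^ 3 * (‖y‖ - 1))⁻¹ : ℝ) : ℂ) * L y =
      ((∑ α : Fin 2, ∑ β : Fin 2,
          star ((pushA Fmap Gmap Ab α β y).mulVec (pd β φ y)) ⬝ᵥ pd α φ y) -
          (((‖y‖ ^ 3 * (‖y‖ - 1))⁻¹ : ℝ) : ℂ) * L y) +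
        star ((pushB Fmap Gmap Bb y).mulVec (φ y)) ⬝ᵥ φ y := by
      rw [hf]; ring
    rw [e]
    refine (norm_add_le _ _).trans ((add_le_add hA hB).trans_eq ?_)
    rw [hC]; ring
  constructor
  · intro hint y0 hy0 p0
    by_contra hne
    have hWc : ContinuousAt (fun y => W y p0) y0 :=
      ((W_contDiffOn φ U hU hφ p0).continuousOn).continuousAt
        (hU.mem_nhds (hUsub (by rw [mem_closedBall_zero_iff, hy0]; norm_num)))
    have hpos : 0 < ‖W y0 p0‖ := norm_pos_iff.2 hne
    have hev := hWc.norm.eventually_const_lt (u := ‖W y0 p0‖ / 2) (half_lt_self hpos)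
    obtain ⟨ρ, hρ, hball⟩ := Metric.eventually_nhds_iff_ball.1 hev
    set δ := ‖W y0 p0‖ / 2 with hδ
    have hδ0 : 0 < δ := by positivity
    refine not_int (fun y => (f y).re) y0 hy0 (c₁ * δ ^ 2 / 2) C ρ (by positivity) hC0 hρ hint.re ?_
    intro y hyb h1 h2
    have hWy := hball y hyb
    have hL : c₁ * (‖y‖ ^ 2 * δ ^ 2) ≤ (L y).re := by
      refine le_trans ?_ (hAreg (Gmap y) (fun l => perp y l • W y)).1
      have e : (∑ l : Fin 2, ∑ p : Fin m, ‖(perp y l • W y) p‖ ^ 2) =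
          ‖y‖ ^ 2 * ∑ p : Fin m, ‖W y p‖ ^ 2 := by
        simp only [Pi.smul_apply, norm_smul, mul_pow, ← Finset.mul_sum, Fin.sum_univ_two,
          perp_zero, perp_one, norm_sq_two, Real.norm_eq_abs, sq_abs]
        ring
      rw [e]
      have : δ ^ 2 ≤ ∑ p : Fin m, ‖W y p‖ ^ 2 :=
        (pow_le_pow_left₀ hδ0.le hWy.le 2).trans
          (Finset.single_le_sum (f := fun p => ‖W y p‖ ^ 2) (fun _ _ => by positivity)
            (Finset.mem_univ p0))
      gcongr
    have hre := (Complex.abs_re_le_norm _).trans (hsplit y h1 h2)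
    rw [Complex.sub_re, Complex.re_ofReal_mul] at hre
    have hlow := (abs_le.1 hre).1
    have hr1 : 0 < ‖y‖ - 1 := by linarith
    have hk : c₁ * δ ^ 2 / 2 / (‖y‖ - 1) ≤ (‖y‖ ^ 3 * (‖y‖ - 1))⁻¹ * (L y).re := by
      have hr : 0 < ‖y‖ := by linarith
      have h3 : (‖y‖ ^ 3 * (‖y‖ - 1))⁻¹ * (c₁ * (‖y‖ ^ 2 * δ ^ 2)) ≤
          (‖y‖ ^ 3 * (‖y‖ - 1))⁻¹ * (L y).re := by gcongr
      refine le_trans ?_ h3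
      have h4 : (‖y‖ ^ 3 * (‖y‖ - 1))⁻¹ * (c₁ * (‖y‖ ^ 2 * δ ^ 2)) =
          c₁ * δ ^ 2 / ‖y‖ / (‖y‖ - 1) := by field_simp
      rw [h4]
      gcongr
    show _ ≤ (f y).re
    linarith
  · intro h0
    obtain ⟨K, hK0, hK⟩ := W_lip φ U hU hUsub hφ h0
    have hms : MeasurableSet (ball (0 : E2) 2 \ closedBall 0 1) :=
      measurableSet_ball.diff measurableSet_closedBall
    have hsubU : ball (0 : E2) 2 \ closedBall 0 1 ⊆ U :=
      fun y hy => hUsub (ball_subset_closedBall hy.1)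
    refine IntegrableOn.of_bound
      ((measure_mono Set.sdiff_subset).trans_lt measure_ball_lt_top)
      (f_meas Ab Bb hAmeas hBmeas φ _ hms (hφ.continuousOn.mono hsubU)).aestronglyMeasurable
      (C + 4 * (m * (m * (M * (2 * K)) * (2 * K)))) ?_
    refine (ae_restrict_iff' hms).2 (Filter.Eventually.of_forall fun y hy => ?_)
    rw [Set.mem_sdiff, mem_ball_zero_iff, mem_closedBall_zero_iff, not_le] at hy
    obtain ⟨h2, h1⟩ := hy
    have hr1 : 0 < ‖y‖ - 1 := by linarith
    have hr : 0 < ‖y‖ := by linarith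
    set b := 2 * K * (‖y‖ - 1) with hb
    have hb0 : 0 ≤ b := by positivity
    have hWb : ∀ i p, ‖(perp y i • W y) p‖ ≤ b := by
      intro i p
      rw [Pi.smul_apply, norm_smul, Real.norm_eq_abs, hb, mul_assoc]
      exact mul_le_mul ((abs_perp_le y i).trans h2.le) (hK y h1 h2 p) (norm_nonneg _) (by norm_num)
    have hLb : ‖L y‖ ≤ 4 * (m * (m * (M * b) * b)) := by
      have hh := fun α β => form_bound (Ab α β (Gmap y)) M b b (hAbd α β _) _ _ (hWb β) (hWb α) hM hb0
      simp only [L, Fin.sum_univ_two]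
      refine (norm_add_le _ _).trans ?_
      have g1 := (norm_add_le _ _).trans (add_le_add (hh 0 0) (hh 0 1))
      have g2 := (norm_add_le _ _).trans (add_le_add (hh 1 0) (hh 1 1))
      linarith
    have hkL : ‖(((‖y‖ ^ 3 * (‖y‖ - 1))⁻¹ : ℝ) : ℂ) * L y‖ ≤
        4 * (m * (m * (M * (2 * K)) * (2 * K))) := by
      rw [norm_mul, Complex.norm_real, Real.norm_of_nonneg (by positivity),
        inv_mul_le_iff₀ (by positivity)]
      refine hLb.trans ?_
      have e : 4 * (m * (m * (M * b) * b)) = (‖y‖ - 1) * (‖y‖ - 1) *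
        (4 * (m * (m * (M * (2 * K)) * (2 * K)))) := by rw [hb]; ring
      rw [e]
      have : ‖y‖ - 1 ≤ ‖y‖ ^ 3 := by
        have : 1 ≤ ‖y‖ ^ 2 := one_le_pow₀ h1.le
        nlinarith
      gcongr
    have e : f y = (f y - (((‖y‖ ^ 3 * (‖y‖ - 1))⁻¹ : ℝ) : ℂ) * L y) +
        (((‖y‖ ^ 3 * (‖y‖ - 1))⁻¹ : ℝ) : ℂ) * L y := by ring
    rw [e]
    exact (norm_add_le _ _).trans (add_le_add (hsplit y h1 h2) hkL)
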